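/- Iterates of the optimal-stopping operators: in the notation below, for every k ≥ 1, every (x₀, …, x_{d₁+1}) ∈ E^{d₁+2} and every α ∈ [0,1], (Q^k h)(x₀, …, x_{d₁+1}, α) = (1 − α) · max{ λ(x₀, …, x_{d₁+1}), r_{k−1}(x₁, …, x_{d₁+1}) }, and for every k ≥ 0, (T Q^k h)(x₀, …, x_{d₁+1}, α) = (1 − α) · r_k(x₁, …, x_{d₁+1}). -/

import Mathlib

open MeasureTheory Finset
open scoped NNReal ENNReal

noncomputable section

/-- `G₁(z, y, α) = α f¹(z,y) + (1-α)(q f¹(z,y) + p f⁰(z,y))`. -/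
def G1fn {E : Type*} (f0 f1 : E → E → ℝ≥0) (p : ℝ) (z y : E) (α : ℝ) : ℝ :=
  α * (f1 z y : ℝ) + (1 - α) * ((1 - p) * (f1 z y : ℝ) + p * (f0 z y : ℝ))

/-- The posterior update `Π'(z, y, α) = f¹(z,y)(q + pα)/G₁(z,y,α)`, with the convention
`Π' = 1` when `G₁(z,y,α) = 0`. -/
def PiUpd {E : Type*} (f0 f1 : E → E → ℝ≥0) (p : ℝ) (z y : E) (α : ℝ) : ℝ :=
  if G1fn f0 f1 p z y α = 0 then 1 else (f1 z y : ℝ) * ((1 - p) + p * α) / G1fn f0 f1 p z y α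

/-- The one-step operator
`(T u)(x₀,…,x_{d₁+1}, α) = ∫ u(x₁,…,x_{d₁+1}, y, Π'(x_{d₁+1}, y, α)) G₁(x_{d₁+1}, y, α) μ(dy)`. -/
def Tstep {E : Type*} [MeasurableSpace E] (μ : Measure E) (f0 f1 : E → E → ℝ≥0) (p : ℝ) (d₁ : ℕ)
    (u : (Fin (d₁ + 2) → E) → ℝ → ℝ) (xv : Fin (d₁ + 2) → E) (α : ℝ) : ℝ :=
  ∫ y, u (Fin.snoc (fun i : Fin (d₁ + 1) => xv i.succ) y)
      (PiUpd f0 f1 p (xv (Fin.last (d₁ + 1))) y α) *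
    G1fn f0 f1 p (xv (Fin.last (d₁ + 1))) y α ∂μ

end

noncomputable section

/-- `L_m(x_k, …, x_N) = ∏_{r=k+1}^{N-m} f⁰(x_{r-1}, x_r) · ∏_{r=N-m+1}^{N} f¹(x_{r-1}, x_r)`. -/
def Lfn {E : Type*} (f0 f1 : E → E → ℝ≥0) (k N m : ℕ) (xv : ℕ → E) : ℝ≥0 :=
  (∏ r ∈ Finset.Icc (k + 1) (N - m), f0 (xv (r - 1)) (xv r)) *
    ∏ r ∈ Finset.Icc (N - m + 1) N, f1 (xv (r - 1)) (xv r)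

/-- Reindexing of a finite vector as a map `ℕ → E` (indices `0, …, N-1`). -/
def ofFin {E : Type*} {N : ℕ} [NeZero N] (xs : Fin N → E) : ℕ → E := fun r =>
  xs ⟨r % N, Nat.mod_lt r (NeZero.pos N)⟩

/-- `λ(x₀,…,x_{d₁+1}) = 1 - p^{d₂} + q ∑_{m=1}^{d₁+1} L_m/(p^m L₀)`,
the `L`'s evaluated at `(x₀, …, x_{d₁+1})`. -/
def lamfn {E : Type*} (f0 f1 : E → E → ℝ≥0) (p : ℝ) (d₁ d₂ : ℕ) (xs : Fin (d₁ + 2) → E) : ℝ :=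
  1 - p ^ d₂ + (1 - p) * ∑ m ∈ Finset.Icc 1 (d₁ + 1),
    (Lfn f0 f1 0 (d₁ + 1) m (ofFin xs) : ℝ) / (p ^ m * (Lfn f0 f1 0 (d₁ + 1) 0 (ofFin xs) : ℝ))

/-- The payoff `h(x₀,…,x_{d₁+1}, α) = (1 - α) λ(x₀,…,x_{d₁+1})`. -/
def hpay {E : Type*} (f0 f1 : E → E → ℝ≥0) (p : ℝ) (d₁ d₂ : ℕ)
    (xs : Fin (d₁ + 2) → E) (α : ℝ) : ℝ :=
  (1 - α) * lamfn f0 f1 p d₁ d₂ xs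

/-- The operator `Q u = max (u, T u)` (pointwise maximum). -/
def Qop {E : Type*} [MeasurableSpace E] (μ : Measure E) (f0 f1 : E → E → ℝ≥0) (p : ℝ) (d₁ : ℕ)
    (u : (Fin (d₁ + 2) → E) → ℝ → ℝ) : (Fin (d₁ + 2) → E) → ℝ → ℝ :=
  fun xs α => max (u xs α) (Tstep μ f0 f1 p d₁ u xs α)

/-- The functions `r_k`:
`r₀(x₁,…,x_{d₁+1}) = p (1 - p^{d₂} + q ∑_{m=1}^{d₁+1} L_{m-1}/(p^m L₀))` and
`r_k(x₁,…,x_{d₁+1}) = p ∫ f⁰(x_{d₁+1}, y) max{λ(x₁,…,x_{d₁+1},y), r_{k-1}(x₂,…,x_{d₁+1},y)} μ(dy)`. -/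
def rfn {E : Type*} [MeasurableSpace E] (μ : Measure E) (f0 f1 : E → E → ℝ≥0) (p : ℝ)
    (d₁ d₂ : ℕ) : ℕ → (Fin (d₁ + 1) → E) → ℝ
  | 0 => fun xs =>
      p * (1 - p ^ d₂ + (1 - p) * ∑ m ∈ Finset.Icc 1 (d₁ + 1),
        (Lfn f0 f1 0 d₁ (m - 1) (ofFin xs) : ℝ) / (p ^ m * (Lfn f0 f1 0 d₁ 0 (ofFin xs) : ℝ)))
  | (k + 1) => fun xs =>
      p * ∫ y, (f0 (xs (Fin.last d₁)) y : ℝ) *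
        max (lamfn f0 f1 p d₁ d₂ (Fin.snoc xs y))
          (rfn μ f0 f1 p d₁ d₂ k (Fin.snoc (fun i : Fin d₁ => xs i.succ) y)) ∂μ

end

theorem aux_G1_nonneg {E : Type*} (f0 f1 : E → E → ℝ≥0) {p : ℝ} (hp : p ∈ Set.Ioo (0 : ℝ) 1)
    (z y : E) {α : ℝ} (hα : α ∈ Set.Icc (0 : ℝ) 1) :
    0 ≤ (f1 z y : ℝ) * ((1 - p) + p * α) ∧
    (f1 z y : ℝ) * ((1 - p) + p * α) ≤ G1fn f0 f1 p z y α := by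
  obtain ⟨hp0, hp1⟩ := hp
  obtain ⟨h0, h1⟩ := hα
  have a1 : 0 ≤ 1 - p := by linarith
  have a2 : 0 ≤ 1 - α := by linarith
  have a3 : 0 ≤ (1 - α) * p * (f0 z y : ℝ) := by positivity
  refine ⟨by positivity, ?_⟩
  have : G1fn f0 f1 p z y α = (f1 z y : ℝ) * ((1 - p) + p * α) + (1 - α) * p * (f0 z y : ℝ) := by
    unfold G1fn; ring
  linarith

theorem aux_Pi_mem {E : Type*} (f0 f1 : E → E → ℝ≥0) {p : ℝ} (hp : p ∈ Set.Ioo (0 : ℝ) 1)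
    (z y : E) {α : ℝ} (hα : α ∈ Set.Icc (0 : ℝ) 1) :
    PiUpd f0 f1 p z y α ∈ Set.Icc (0 : ℝ) 1 := by
  obtain ⟨h1, h2⟩ := aux_G1_nonneg f0 f1 hp z y hα
  unfold PiUpd
  split_ifs with h
  · simp
  · exact ⟨div_nonneg h1 (h1.trans h2), div_le_one_of_le₀ h2 (h1.trans h2)⟩

theorem aux_Pi_mul {E : Type*} (f0 f1 : E → E → ℝ≥0) {p : ℝ} (hp : p ∈ Set.Ioo (0 : ℝ) 1)
    (z y : E) {α : ℝ} (hα : α ∈ Set.Icc (0 : ℝ) 1) :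
    (1 - PiUpd f0 f1 p z y α) * G1fn f0 f1 p z y α = (1 - α) * p * (f0 z y : ℝ) := by
  obtain ⟨h1, h2⟩ := aux_G1_nonneg f0 f1 hp z y hα
  have e : G1fn f0 f1 p z y α = (f1 z y : ℝ) * ((1 - p) + p * α) + (1 - α) * p * (f0 z y : ℝ) := by
    unfold G1fn; ring
  unfold PiUpd
  split_ifs with h
  · have a2 : 0 ≤ 1 - α := by linarith [hα.2]
    have a3 : 0 ≤ (1 - α) * p * (f0 z y : ℝ) :=
      mul_nonneg (mul_nonneg a2 hp.1.le) (NNReal.coe_nonneg _)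
    rw [h] at e ⊢
    linarith
  · rw [sub_mul, div_mul_cancel₀ _ h]
    linarith

theorem aux_T {E : Type*} [MeasurableSpace E] (μ : Measure E) (f0 f1 : E → E → ℝ≥0) {p : ℝ}
    (hp : p ∈ Set.Ioo (0 : ℝ) 1) (d₁ : ℕ)
    (u : (Fin (d₁ + 2) → E) → ℝ → ℝ) (g : (Fin (d₁ + 2) → E) → ℝ)
    (hu : ∀ xs α, α ∈ Set.Icc (0 : ℝ) 1 → u xs α = (1 - α) * g xs)
    (xs : Fin (d₁ + 2) → E) (α : ℝ) (hα : α ∈ Set.Icc (0 : ℝ) 1) :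
    Tstep μ f0 f1 p d₁ u xs α = (1 - α) * (p * ∫ y, (f0 (xs (Fin.last (d₁ + 1))) y : ℝ) *
      g (Fin.snoc (fun i : Fin (d₁ + 1) => xs i.succ) y) ∂μ) := by
  unfold Tstep
  rw [← mul_assoc, ← integral_const_mul]
  congr 1
  funext y
  rw [hu _ _ (aux_Pi_mem f0 f1 hp _ y hα), mul_right_comm, aux_Pi_mul f0 f1 hp _ y hα]
  ring

theorem aux_tail_snoc {E : Type*} {d : ℕ} (xs : Fin (d + 1) → E) (y : E) :
    (fun i : Fin (d + 1) => (Fin.snoc xs y : Fin (d + 2) → E) i.succ) =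
      Fin.snoc (fun i : Fin d => xs i.succ) y := by
  funext i
  induction i using Fin.lastCases with
  | last =>
    rw [Fin.succ_last, Fin.snoc_last, Fin.snoc_last]
  | cast j =>
    rw [Fin.succ_castSucc, Fin.snoc_castSucc, Fin.snoc_castSucc]

theorem aux_ofFin_lt {E : Type*} {d : ℕ} (xs : Fin (d + 1) → E) (y : E) (r : ℕ) (hr : r ≤ d) :
    ofFin (Fin.snoc xs y : Fin (d + 2) → E) r = ofFin xs r := by
  unfold ofFin
  have h1 : r % (d + 2) = r := Nat.mod_eq_of_lt (by omega)
  have h2 : r % (d + 1) = r := Nat.mod_eq_of_lt (by omega)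
  have h3 : (⟨r % (d + 2), Nat.mod_lt r (NeZero.pos (d + 2))⟩ : Fin (d + 2)) =
      Fin.castSucc ⟨r % (d + 1), Nat.mod_lt r (NeZero.pos (d + 1))⟩ := by
    ext; simp [h1, h2]
  rw [h3, Fin.snoc_castSucc]

theorem aux_ofFin_last {E : Type*} {d : ℕ} (xs : Fin (d + 1) → E) :
    ofFin xs d = xs (Fin.last d) := by
  unfold ofFin
  congr 1
  ext; simp

theorem aux_Lfn_succ {E : Type*} (f0 f1 : E → E → ℝ≥0) {d : ℕ} (xs : Fin (d + 1) → E) (y : E)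
    (m : ℕ) :
    Lfn f0 f1 0 (d + 1) (m + 1) (ofFin (Fin.snoc xs y : Fin (d + 2) → E)) =
      Lfn f0 f1 0 d m (ofFin xs) * f1 (xs (Fin.last d)) y := by
  unfold Lfn
  have e : d + 1 - (m + 1) = d - m := by omega
  rw [e, Finset.prod_Icc_succ_top (by omega : d - m + 1 ≤ d + 1), mul_assoc]
  congr 1
  · refine Finset.prod_congr rfl fun r hr => ?_
    rw [Finset.mem_Icc] at hr
    rw [aux_ofFin_lt _ _ _ (by omega), aux_ofFin_lt _ _ _ (by omega)]
  · congr 1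
    · refine Finset.prod_congr rfl fun r hr => ?_
      rw [Finset.mem_Icc] at hr
      rw [aux_ofFin_lt _ _ _ (by omega), aux_ofFin_lt _ _ _ (by omega)]
    · rw [Nat.add_sub_cancel, aux_ofFin_lt _ _ _ le_rfl, aux_ofFin_last, aux_ofFin_last,
        Fin.snoc_last]

theorem aux_Lfn_zero {E : Type*} (f0 f1 : E → E → ℝ≥0) {d : ℕ} (xs : Fin (d + 1) → E) (y : E) :
    Lfn f0 f1 0 (d + 1) 0 (ofFin (Fin.snoc xs y : Fin (d + 2) → E)) =
      Lfn f0 f1 0 d 0 (ofFin xs) * f0 (xs (Fin.last d)) y := by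
  unfold Lfn
  simp only [Nat.sub_zero]
  rw [Finset.prod_Icc_succ_top (by omega : 0 + 1 ≤ d + 1), Finset.Icc_eq_empty (by omega : ¬ d + 1 + 1 ≤ d + 1),
    Finset.Icc_eq_empty (by omega : ¬ d + 1 ≤ d)]
  simp only [Finset.prod_empty, mul_one]
  congr 1
  · refine Finset.prod_congr rfl fun r hr => ?_
    rw [Finset.mem_Icc] at hr
    rw [aux_ofFin_lt _ _ _ (by omega), aux_ofFin_lt _ _ _ (by omega)]
  · rw [Nat.add_sub_cancel, aux_ofFin_lt _ _ _ le_rfl, aux_ofFin_last, aux_ofFin_last,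
        Fin.snoc_last]

theorem aux_f0_lam {E : Type*} (f0 f1 : E → E → ℝ≥0) (hpos : ∀ z y, 0 < f0 z y) (p : ℝ)
    (d₁ d₂ : ℕ) (xs : Fin (d₁ + 1) → E) (y : E) :
    (f0 (xs (Fin.last d₁)) y : ℝ) * lamfn f0 f1 p d₁ d₂ (Fin.snoc xs y) =
      (1 - p ^ d₂) * (f0 (xs (Fin.last d₁)) y : ℝ) +
      ((1 - p) * ∑ m ∈ Finset.Icc 1 (d₁ + 1),
        (Lfn f0 f1 0 d₁ (m - 1) (ofFin xs) : ℝ) / (p ^ m * (Lfn f0 f1 0 d₁ 0 (ofFin xs) : ℝ))) *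
        (f1 (xs (Fin.last d₁)) y : ℝ) := by
  have hf : (f0 (xs (Fin.last d₁)) y : ℝ) ≠ 0 := by
    exact_mod_cast (hpos _ _).ne'
  unfold lamfn
  rw [mul_add, mul_comm _ (1 - p ^ d₂), mul_left_comm, mul_assoc (1 - p), Finset.mul_sum,
    Finset.sum_mul]
  congr 2
  refine Finset.sum_congr rfl fun m hm => ?_
  obtain ⟨n, rfl⟩ : ∃ n, m = n + 1 := ⟨m - 1, by have := (Finset.mem_Icc.1 hm).1; omega⟩
  rw [aux_Lfn_succ, aux_Lfn_zero, Nat.add_sub_cancel]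
  push_cast
  rw [← mul_assoc, ← mul_div_assoc, mul_comm (f0 _ _ : ℝ), mul_div_mul_right _ _ hf]
  ring

theorem aux_integrable {E : Type*} [MeasurableSpace E] (μ : Measure E)
    (f : E → E → ℝ≥0) (hf : Measurable (Function.uncurry f))
    (hi : ∀ z, ∫⁻ y, (f z y : ℝ≥0∞) ∂μ = 1) (z : E) :
    Integrable (fun y => (f z y : ℝ)) μ ∧ ∫ y, (f z y : ℝ) ∂μ = 1 := by
  have hm : Measurable (f z) := hf.comp measurable_prodMk_left
  constructor
  · refine ⟨hm.coe_nnreal_real.aestronglyMeasurable, ?_⟩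
    rw [hasFiniteIntegral_iff_enorm]
    simp [hi z]
  · rw [integral_eq_lintegral_of_nonneg_ae (Filter.Eventually.of_forall fun y => NNReal.coe_nonneg _)
      hm.coe_nnreal_real.aestronglyMeasurable]
    simp [hi z]


/-- Iterates of the optimal-stopping operators: for every `k ≥ 1`,
`(Q^k h)(x₀,…,x_{d₁+1}, α) = (1-α) max{λ(x₀,…,x_{d₁+1}), r_{k-1}(x₁,…,x_{d₁+1})}`,
and for every `k ≥ 0`, `(T Q^k h)(x₀,…,x_{d₁+1}, α) = (1-α) r_k(x₁,…,x_{d₁+1})`. -/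
theorem stmt15 {E : Type*} [MeasurableSpace E] (μ : Measure E) [SigmaFinite μ]
    (f0 f1 : E → E → ℝ≥0) (hf0 : Measurable (Function.uncurry f0))
    (hf1 : Measurable (Function.uncurry f1)) (hpos : ∀ z y, 0 < f0 z y)
    (hi0 : ∀ z, ∫⁻ y, (f0 z y : ℝ≥0∞) ∂μ = 1) (hi1 : ∀ z, ∫⁻ y, (f1 z y : ℝ≥0∞) ∂μ = 1)
    (p : ℝ) (hp : p ∈ Set.Ioo (0 : ℝ) 1) (d₁ d₂ : ℕ)
    (hIntR : ∀ (k : ℕ) (xs : Fin (d₁ + 1) → E),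
      Integrable (fun y => (f0 (xs (Fin.last d₁)) y : ℝ) *
        max (lamfn f0 f1 p d₁ d₂ (Fin.snoc xs y))
          (rfn μ f0 f1 p d₁ d₂ k (Fin.snoc (fun i : Fin d₁ => xs i.succ) y))) μ)
    (hIntT : ∀ (k : ℕ) (xs : Fin (d₁ + 2) → E) (α : ℝ),
      Integrable (fun y =>
        (Qop μ f0 f1 p d₁)^[k] (hpay f0 f1 p d₁ d₂)
            (Fin.snoc (fun i : Fin (d₁ + 1) => xs i.succ) y)
            (PiUpd f0 f1 p (xs (Fin.last (d₁ + 1))) y α) *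
          G1fn f0 f1 p (xs (Fin.last (d₁ + 1))) y α) μ) :
    (∀ k : ℕ, 1 ≤ k → ∀ (xs : Fin (d₁ + 2) → E) (α : ℝ), α ∈ Set.Icc (0 : ℝ) 1 →
        (Qop μ f0 f1 p d₁)^[k] (hpay f0 f1 p d₁ d₂) xs α =
          (1 - α) * max (lamfn f0 f1 p d₁ d₂ xs)
            (rfn μ f0 f1 p d₁ d₂ (k - 1) (fun i : Fin (d₁ + 1) => xs i.succ))) ∧
      ∀ (k : ℕ) (xs : Fin (d₁ + 2) → E) (α : ℝ), α ∈ Set.Icc (0 : ℝ) 1 →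
        Tstep μ f0 f1 p d₁ ((Qop μ f0 f1 p d₁)^[k] (hpay f0 f1 p d₁ d₂)) xs α =
          (1 - α) * rfn μ f0 f1 p d₁ d₂ k (fun i : Fin (d₁ + 1) => xs i.succ) := by
  have hr0 : ∀ xs : Fin (d₁ + 1) → E,
      Integrable (fun y => (f0 (xs (Fin.last d₁)) y : ℝ) * lamfn f0 f1 p d₁ d₂ (Fin.snoc xs y)) μ ∧
      p * ∫ y, (f0 (xs (Fin.last d₁)) y : ℝ) * lamfn f0 f1 p d₁ d₂ (Fin.snoc xs y) ∂μ =
        rfn μ f0 f1 p d₁ d₂ 0 xs := by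
    intro xs
    obtain ⟨i0, j0⟩ := aux_integrable μ f0 hf0 hi0 (xs (Fin.last d₁))
    obtain ⟨i1, j1⟩ := aux_integrable μ f1 hf1 hi1 (xs (Fin.last d₁))
    simp only [aux_f0_lam f0 f1 hpos]
    refine ⟨(i0.const_mul _).add (i1.const_mul _), ?_⟩
    rw [integral_add (i0.const_mul _) (i1.const_mul _), integral_const_mul, integral_const_mul,
      j0, j1, mul_one, mul_one]
    rfl
  have hmono : ∀ (k : ℕ) (xs : Fin (d₁ + 1) → E),
      rfn μ f0 f1 p d₁ d₂ k xs ≤ rfn μ f0 f1 p d₁ d₂ (k + 1) xs := by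
    intro k
    induction k with
    | zero =>
      intro xs
      rw [← (hr0 xs).2]
      change _ ≤ p * _
      refine mul_le_mul_of_nonneg_left ?_ hp.1.le
      refine integral_mono (hr0 xs).1 (hIntR 0 xs) fun y => ?_
      exact mul_le_mul_of_nonneg_left (le_max_left _ _) (NNReal.coe_nonneg _)
    | succ k ih =>
      intro xs
      change p * _ ≤ p * _
      refine mul_le_mul_of_nonneg_left ?_ hp.1.le
      refine integral_mono (hIntR k xs) (hIntR (k + 1) xs) fun y => ?_
      exact mul_le_mul_of_nonneg_left (max_le_max le_rfl (ih _)) (NNReal.coe_nonneg _)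
  have hT0 : ∀ (xs : Fin (d₁ + 2) → E) (α : ℝ), α ∈ Set.Icc (0 : ℝ) 1 →
      Tstep μ f0 f1 p d₁ (hpay f0 f1 p d₁ d₂) xs α =
        (1 - α) * rfn μ f0 f1 p d₁ d₂ 0 (fun i : Fin (d₁ + 1) => xs i.succ) := by
    intro xs α hα
    rw [aux_T μ f0 f1 hp d₁ (hpay f0 f1 p d₁ d₂) (lamfn f0 f1 p d₁ d₂) (fun _ _ _ => rfl) xs α hα,
      ← (hr0 _).2, Fin.succ_last]
  have hTs : ∀ k : ℕ, (∀ (xs : Fin (d₁ + 2) → E) (α : ℝ), α ∈ Set.Icc (0 : ℝ) 1 →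
        (Qop μ f0 f1 p d₁)^[k + 1] (hpay f0 f1 p d₁ d₂) xs α =
          (1 - α) * max (lamfn f0 f1 p d₁ d₂ xs)
            (rfn μ f0 f1 p d₁ d₂ k (fun i : Fin (d₁ + 1) => xs i.succ))) →
      ∀ (xs : Fin (d₁ + 2) → E) (α : ℝ), α ∈ Set.Icc (0 : ℝ) 1 →
        Tstep μ f0 f1 p d₁ ((Qop μ f0 f1 p d₁)^[k + 1] (hpay f0 f1 p d₁ d₂)) xs α =
          (1 - α) * rfn μ f0 f1 p d₁ d₂ (k + 1) (fun i : Fin (d₁ + 1) => xs i.succ) := by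
    intro k hk xs α hα
    rw [aux_T μ f0 f1 hp d₁ _ _ hk xs α hα]
    simp only [aux_tail_snoc]
    rfl
  have hQ : ∀ (k : ℕ) (xs : Fin (d₁ + 2) → E) (α : ℝ), α ∈ Set.Icc (0 : ℝ) 1 →
        (Qop μ f0 f1 p d₁)^[k + 1] (hpay f0 f1 p d₁ d₂) xs α =
          (1 - α) * max (lamfn f0 f1 p d₁ d₂ xs)
            (rfn μ f0 f1 p d₁ d₂ k (fun i : Fin (d₁ + 1) => xs i.succ)) := by
    intro k
    induction k with
    | zero =>
      intro xs α hα
      change max (hpay f0 f1 p d₁ d₂ xs α) (Tstep μ f0 f1 p d₁ (hpay f0 f1 p d₁ d₂) xs α) = _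
      rw [hT0 xs α hα, mul_max_of_nonneg _ _ (by linarith [hα.2])]
      rfl
    | succ k ih =>
      intro xs α hα
      rw [Function.iterate_succ_apply']
      change max _ (Tstep μ f0 f1 p d₁ _ xs α) = _
      rw [hTs k ih xs α hα, ih xs α hα, ← mul_max_of_nonneg _ _ (by linarith [hα.2]),
        max_assoc, max_eq_right (hmono k _)]
  refine ⟨fun k hk xs α hα => ?_, fun k xs α hα => ?_⟩
  · obtain ⟨n, rfl⟩ : ∃ n, k = n + 1 := ⟨k - 1, by omega⟩
    exact hQ n xs α hα
  · cases k with
    | zero => exact hT0 xs α hα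
    | succ k => exact hTs k (hQ k) xs α hα
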